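/- Let a, b, c > 0 and τ ∈ ℕ with τ ≥ 1, set β = (1+b)^τ, suppose a > b·β and c·z₊ ≤ 1, where z₊ is the unique positive equilibrium. Then every solution (z_t)_{t≥0} of the delay recurrence z_{t+1} = H(z_t, z_{t−τ+1}) with nonnegative initial conditions not all zero satisfies lim_{t→∞} z_t = z₊. -/

import Mathlib

/-- `Hfun a b c β u v = (1/m(u)) * (u + a·b·v/M(v))` where `m(x) = 1+b+cx` and
`M(x) = bβ + (β-1)cx`. -/
noncomputable def Hfun (a b c β u v : ℝ) : ℝ :=
  (1 / (1 + b + c * u)) * (u + a * b * v / (b * β + (β - 1) * c * v))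

/-- The positive equilibrium `z₊` of the delayed Beverton–Holt recurrence. -/
noncomputable def zplus (a b c β : ℝ) : ℝ :=
  (-(b * (2 * β - 1)) +
      Real.sqrt ((b * (2 * β - 1)) ^ 2 + 4 * b * (a - b * β) * (β - 1))) /
    (2 * c * (β - 1))

open Filter Topology

noncomputable def ff (a b c β v : ℝ) : ℝ := a * b * v / (b * β + (β - 1) * c * v)

lemma Hfun_eq (a b c β u v : ℝ) :
    Hfun a b c β u v = (u + ff a b c β v) / (1 + b + c * u) := by
  unfold Hfun ff; rw [one_div, inv_mul_eq_div]

lemma zplus_spec {a b c β : ℝ} (hb : 0 < b) (hc : 0 < c) (hβ : 1 < β) (hab : b * β < a) :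
    0 < zplus a b c β ∧
      (b + c * zplus a b c β) * (b * β + (β - 1) * c * zplus a b c β) = a * b := by
  have h1 : 0 < β - 1 := by linarith
  have h2 : 0 < a - b * β := by linarith
  have hpos : 0 < 4 * b * (a - b * β) * (β - 1) := by positivity
  have h3 : 0 < b * (2 * β - 1) := mul_pos hb (by linarith)
  set D := (b * (2 * β - 1)) ^ 2 + 4 * b * (a - b * β) * (β - 1) with hD
  have hs : Real.sqrt D ^ 2 = D := Real.sq_sqrt (by positivity)
  have hlt : b * (2 * β - 1) < Real.sqrt D := Real.lt_sqrt_of_sq_lt (by linarith)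
  have hz : zplus a b c β = (-(b * (2 * β - 1)) + Real.sqrt D) / (2 * c * (β - 1)) := rfl
  constructor
  · rw [hz]; exact div_pos (by linarith) (by positivity)
  · have e : 2 * (β - 1) * (c * zplus a b c β) = -(b * (2 * β - 1)) + Real.sqrt D := by
      rw [hz]; field_simp
    set p := zplus a b c β
    have e2 : (2 * (β - 1) * (c * p) + b * (2 * β - 1)) ^ 2 = D := by
      rw [e]; linear_combination hs
    have e3 : 4 * (β - 1) * ((b + c * p) * (b * β + (β - 1) * c * p) - a * b) = 0 := by
      rw [hD] at e2; linear_combination e2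
    rcases mul_eq_zero.1 e3 with h | h
    · linarith
    · linarith

lemma ff_mono {a b c β v w : ℝ} (ha : 0 < a) (hb : 0 < b) (hc : 0 < c) (hβ : 1 < β)
    (hv : 0 ≤ v) (hvw : v ≤ w) : ff a b c β v ≤ ff a b c β w := by
  have h1 : 0 < β - 1 := by linarith
  have hw : 0 ≤ w := hv.trans hvw
  have h0 : 0 < β := by linarith
  unfold ff
  rw [div_le_div_iff₀ (by positivity) (by positivity)]
  have : 0 ≤ a * b * (b * β) * (w - v) := mul_nonneg (by positivity) (by linarith)
  nlinarith

lemma ff_nonneg {a b c β v : ℝ} (ha : 0 < a) (hb : 0 < b) (hc : 0 < c) (hβ : 1 < β)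
    (hv : 0 ≤ v) : 0 ≤ ff a b c β v := by
  have h1 : 0 < β - 1 := by linarith
  have h0 : 0 < β := by linarith
  unfold ff; positivity

lemma Hfun_mono_right {a b c β u v w : ℝ} (ha : 0 < a) (hb : 0 < b) (hc : 0 < c) (hβ : 1 < β)
    (hu : 0 ≤ u) (hv : 0 ≤ v) (hvw : v ≤ w) : Hfun a b c β u v ≤ Hfun a b c β u w := by
  rw [Hfun_eq, Hfun_eq]
  have := ff_mono ha hb hc hβ hv hvw
  gcongr

noncomputable def GG (a b c β W : ℝ) : ℝ := max (Hfun a b c β 0 W) (Hfun a b c β W W)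

lemma Hfun_le_GG {a b c β u v W : ℝ} (ha : 0 < a) (hb : 0 < b) (hc : 0 < c) (hβ : 1 < β)
    (hu : 0 ≤ u) (hv : 0 ≤ v) (huW : u ≤ W) (hvW : v ≤ W) :
    Hfun a b c β u v ≤ GG a b c β W := by
  refine (Hfun_mono_right ha hb hc hβ hu hv hvW).trans ?_
  have hW : 0 ≤ W := hu.trans huW
  unfold GG
  rw [Hfun_eq, Hfun_eq, Hfun_eq]
  set F := ff a b c β W
  rcases le_total (c * F) (1 + b) with h | h
  · refine le_max_of_le_right ?_
    rw [div_le_div_iff₀ (by positivity) (by positivity)]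
    nlinarith [mul_nonneg (sub_nonneg.2 h) (sub_nonneg.2 huW)]
  · refine le_max_of_le_left ?_
    rw [div_le_div_iff₀ (by positivity) (by positivity)]
    nlinarith [mul_nonneg (sub_nonneg.2 h) hu]

lemma GG_lt {a b c β p W : ℝ} (hb : 0 < b) (hc : 0 < c) (hβ : 1 < β)
    (hp : 0 < p) (hcp : c * p ≤ 1)
    (heq : (b + c * p) * (b * β + (β - 1) * c * p) = a * b) (hW : p < W) :
    GG a b c β W < W := by
  have h1 : 0 < β - 1 := by linarith
  have h0 : 0 < β := by linarith
  have hW0 : 0 < W := hp.trans hW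
  have hF : ff a b c β W < W * (b + c * p) := by
    unfold ff
    rw [div_lt_iff₀ (by positivity), ← heq]
    have : 0 < W * (b + c * p) * ((β - 1) * c * (W - p)) :=
      mul_pos (by positivity) (mul_pos (by positivity) (by linarith))
    nlinarith
  unfold GG
  rw [Hfun_eq, Hfun_eq]
  apply max_lt
  · rw [div_lt_iff₀ (by positivity)]
    nlinarith
  · rw [div_lt_iff₀ (by positivity)]
    nlinarith [mul_pos hW0 (mul_pos hc (sub_pos.2 hW))]

lemma le_Hfun {a b c β p u v w : ℝ} (ha : 0 < a) (hb : 0 < b) (hc : 0 < c) (hβ : 1 < β)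
    (hp : 0 < p) (hcp : c * p ≤ 1)
    (heq : (b + c * p) * (b * β + (β - 1) * c * p) = a * b) (hw : 0 < w) (hwp : w ≤ p)
    (hu : w ≤ u) (hv : w ≤ v) : Hfun a b c β w w ≤ Hfun a b c β u v := by
  have h1 : 0 < β - 1 := by linarith
  have h0 : 0 < β := by linarith
  have hu0 : 0 < u := hw.trans_le hu
  refine le_trans ?_ (Hfun_mono_right ha hb hc hβ hu0.le hw.le hv)
  have hfp : ff a b c β p = p * (b + c * p) := by
    unfold ff
    rw [div_eq_iff (by positivity), ← heq]; ring
  have hF : c * ff a b c β w ≤ 1 + b := by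
    have := ff_mono ha hb hc hβ hw.le hwp
    rw [hfp] at this
    have h2 := mul_le_mul_of_nonneg_left this hc.le
    have hcp0 : 0 < c * p := by positivity
    nlinarith
  rw [Hfun_eq, Hfun_eq]
  rw [div_le_div_iff₀ (by positivity) (by positivity)]
  nlinarith [mul_nonneg (sub_nonneg.2 hF) (sub_nonneg.2 hu)]

lemma lt_Hfun {a b c β p w : ℝ} (hb : 0 < b) (hc : 0 < c) (hβ : 1 < β)
    (hp : 0 < p)
    (heq : (b + c * p) * (b * β + (β - 1) * c * p) = a * b) (hw : 0 < w) (hwp : w < p) :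
    w < Hfun a b c β w w := by
  have h1 : 0 < β - 1 := by linarith
  have h0 : 0 < β := by linarith
  have hF : w * (b + c * p) < ff a b c β w := by
    unfold ff
    rw [lt_div_iff₀ (by positivity), ← heq]
    have : 0 < w * (b + c * p) * ((β - 1) * c * (p - w)) :=
      mul_pos (by positivity) (mul_pos (by positivity) (by linarith))
    nlinarith
  rw [Hfun_eq, lt_div_iff₀ (by positivity)]
  nlinarith [mul_pos hw (mul_pos hc (sub_pos.2 hwp))]

lemma Hfun_cont {a b c β W : ℝ} (hb : 0 < b) (hc : 0 < c) (hβ : 1 < β) (hW : 0 < W) :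
    ContinuousAt (fun w => Hfun a b c β w w) W ∧ ContinuousAt (fun w => GG a b c β w) W := by
  have h1 : 0 < β - 1 := by linarith
  have h0 : 0 < β := by linarith
  have n1 : 1 + b + c * W ≠ 0 := by positivity
  have n2 : b * β + (β - 1) * c * W ≠ 0 := by positivity
  have n3 : 1 + b + c * 0 ≠ 0 := by rw [mul_zero]; positivity
  have A : ContinuousAt (fun w => Hfun a b c β w w) W := by
    unfold Hfun; fun_prop (disch := assumption)
  have B : ContinuousAt (fun w => Hfun a b c β 0 w) W := by
    unfold Hfun; fun_prop (disch := assumption)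
  exact ⟨A, B.max A⟩

lemma exists_lower (y : ℕ → ℝ) (n : ℕ) (h : ∀ i < n, 0 < y i) :
    ∃ δ > 0, ∀ i < n, δ ≤ y i := by
  induction n with
  | zero => exact ⟨1, one_pos, by simp⟩
  | succ n ih =>
    obtain ⟨δ, hδ, H⟩ := ih (fun i hi => h i (by omega))
    refine ⟨min δ (y n), lt_min hδ (h n (by omega)), fun i hi => ?_⟩
    rcases Nat.lt_succ_iff_lt_or_eq.1 hi with h' | rfl
    · exact (min_le_left _ _).trans (H i h')
    · exact min_le_right _ _

lemma main_aux {a b c β p : ℝ} (ha : 0 < a) (hb : 0 < b) (hc : 0 < c) (hβ : 1 < β)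
    (hp : 0 < p) (hcp : c * p ≤ 1)
    (heq : (b + c * p) * (b * β + (β - 1) * c * p) = a * b)
    (τ : ℕ) (hτ : 1 ≤ τ) (z : ℕ → ℝ) (hinit : ∀ i, i < τ → 0 ≤ z i)
    (hnz : ¬ ∀ i, i < τ → z i = 0)
    (hrec : ∀ n, τ ≤ n → z n = Hfun a b c β (z (n - 1)) (z (n - τ))) :
    Tendsto z atTop (𝓝 p) := by
  have hnn : ∀ n, 0 ≤ z n := by
    intro n
    induction n using Nat.strong_induction_on with
    | _ n ih =>
      rcases lt_or_ge n τ with h | h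
      · exact hinit n h
      · rw [hrec n h, Hfun_eq]
        have := ih (n - 1) (by omega)
        have := ff_nonneg ha hb hc hβ (ih (n - τ) (by omega))
        positivity
  have hpos : ∀ n, 2 * τ ≤ n → 0 < z n := by
    push Not at hnz
    obtain ⟨i, hi, hzi⟩ := hnz
    have hi0 : 0 < z i := lt_of_le_of_ne (hnn i) (Ne.symm hzi)
    have key : ∀ n, i + τ ≤ n → 0 < z n := by
      intro n hn
      induction n, hn using Nat.le_induction with
      | base =>
        rw [hrec _ (by omega), Hfun_eq, Nat.add_sub_cancel]
        have h1 := hnn (i + τ - 1)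
        have h2 : 0 < ff a b c β (z i) := by
          have h1 : 0 < β - 1 := by linarith
          have h0 : 0 < β := by linarith
          unfold ff; positivity
        positivity
      | succ n hn ih =>
        rw [hrec _ (by omega), Hfun_eq, Nat.add_sub_cancel]
        have h2 := ff_nonneg ha hb hc hβ (hnn (n + 1 - τ))
        positivity
    exact fun n hn => key n (by omega)
  have hub : ∃ K, ∀ n, z n ≤ K := by
    obtain ⟨K, hK⟩ : ∃ K, ∀ i < τ, z i ≤ K :=
      ⟨∑ i ∈ Finset.range τ, z i, fun i hi =>
        Finset.single_le_sum (f := z) (fun j _ => hnn j) (Finset.mem_range.2 hi)⟩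
    refine ⟨max K (p + 1), fun n => ?_⟩
    induction n using Nat.strong_induction_on with
    | _ n ih =>
      rcases lt_or_ge n τ with h | h
      · exact (hK n h).trans (le_max_left _ _)
      · rw [hrec n h]
        exact (Hfun_le_GG ha hb hc hβ (hnn _) (hnn _) (ih _ (by omega)) (ih _ (by omega))).trans
          (GG_lt hb hc hβ hp hcp heq (lt_max_of_lt_right (by linarith))).le
  have hlb : ∃ δ > 0, ∀ n, 2 * τ ≤ n → δ ≤ z n := by
    obtain ⟨δ, hδ, hK⟩ := exists_lower (fun i => z (2 * τ + i)) τ (fun i _ => hpos _ (by omega))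
    have hm : 0 < min δ (p / 2) := lt_min hδ (by linarith)
    have hmp : min δ (p / 2) < p := min_lt_of_right_lt (by linarith)
    refine ⟨min δ (p / 2), hm, fun n => ?_⟩
    induction n using Nat.strong_induction_on with
    | _ n ih =>
      intro hn
      rcases lt_or_ge n (3 * τ) with h | h
      · have := hK (n - 2 * τ) (by omega)
        simp only [Nat.add_sub_cancel' hn] at this
        exact (min_le_left _ _).trans this
      · rw [hrec n (by omega)]
        exact (lt_Hfun hb hc hβ hp heq hm hmp).le.trans
          (le_Hfun ha hb hc hβ hp hcp heq hm hmp.le (ih _ (by omega) (by omega))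
            (ih _ (by omega) (by omega)))
  obtain ⟨K, hK⟩ := hub
  obtain ⟨δ, hδ, hδz⟩ := hlb
  have bA : IsBoundedUnder (· ≤ ·) atTop z := isBoundedUnder_of ⟨K, hK⟩
  have bB : IsBoundedUnder (· ≥ ·) atTop z := isBoundedUnder_of ⟨0, hnn⟩
  have t1 : Tendsto (fun n : ℕ => n - 1) atTop atTop := tendsto_sub_atTop_nat 1
  have t2 : Tendsto (fun n : ℕ => n - τ) atTop atTop := tendsto_sub_atTop_nat τ
  have hsup : limsup z atTop ≤ p := by
    by_contra! hS
    set S := limsup z atTop with hSdef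
    have hG := GG_lt hb hc hβ hp hcp heq hS
    have hev := (Hfun_cont (a := a) hb hc hβ (hp.trans hS)).2.tendsto.eventually_lt_const hG
    obtain ⟨W, hW1, hW2⟩ :=
      ((hev.filter_mono nhdsWithin_le_nhds).and (self_mem_nhdsWithin (s := Set.Ioi S))).exists
    have hzW : ∀ᶠ n in atTop, z n < W := eventually_lt_of_limsup_lt hW2 bA
    have : limsup z atTop ≤ GG a b c β W := by
      refine limsup_le_of_le bB.isCoboundedUnder_le ?_
      filter_upwards [t1.eventually hzW, t2.eventually hzW, eventually_ge_atTop τ] with n h1 h2 h3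
      rw [hrec n h3]
      exact Hfun_le_GG ha hb hc hβ (hnn _) (hnn _) h1.le h2.le
    linarith
  have hinf : p ≤ liminf z atTop := by
    by_contra! hS
    set S := liminf z atTop with hSdef
    have hSpos : δ ≤ S := le_liminf_of_le bA.isCoboundedUnder_ge
      ((eventually_ge_atTop (2 * τ)).mono hδz)
    have hS0 : 0 < S := hδ.trans_le hSpos
    have hG := lt_Hfun hb hc hβ hp heq hS0 hS
    have hev := (Hfun_cont (a := a) hb hc hβ hS0).1.tendsto.eventually_const_lt hG
    have hev2 := hev.and (lt_mem_nhds hS0)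
    obtain ⟨W, ⟨hW1, hW0⟩, hW2⟩ :=
      ((hev2.filter_mono nhdsWithin_le_nhds).and (self_mem_nhdsWithin (s := Set.Iio S))).exists
    have hW2 : W < S := hW2
    have hzW : ∀ᶠ n in atTop, W < z n := eventually_lt_of_lt_liminf hW2 bB
    have : Hfun a b c β W W ≤ liminf z atTop := by
      refine le_liminf_of_le bA.isCoboundedUnder_ge ?_
      filter_upwards [t1.eventually hzW, t2.eventually hzW, eventually_ge_atTop τ] with n h1 h2 h3
      rw [hrec n h3]
      exact le_Hfun ha hb hc hβ hp hcp heq hW0 (hW2.trans hS).le h1.le h2.le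
    linarith
  exact tendsto_of_le_liminf_of_limsup_le hinf hsup bA bB

/-- Global asymptotic stability of the positive equilibrium when `c·z₊ ≤ 1`:
if `a > b·β` and `c·z₊ ≤ 1`, every solution with nonnegative initial
conditions, not all zero, converges to `z₊`. -/
theorem stmt14 (a b c : ℝ) (ha : 0 < a) (hb : 0 < b) (hc : 0 < c)
    (τ : ℕ) (hτ : 1 ≤ τ) (hab : b * (1 + b) ^ τ < a)
    (hcz : c * zplus a b c ((1 + b) ^ τ) ≤ 1)
    (z : ℕ → ℝ) (hinit : ∀ i, i < τ → 0 ≤ z i)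
    (hnz : ¬ ∀ i, i < τ → z i = 0)
    (hrec : ∀ t, z (t + τ) = Hfun a b c ((1 + b) ^ τ) (z (t + τ - 1)) (z t)) :
    Filter.Tendsto z Filter.atTop (nhds (zplus a b c ((1 + b) ^ τ))) := by
  have h1b : 1 < (1 + b) ^ τ := one_lt_pow₀ (by linarith) (by omega)
  obtain ⟨hp, heq⟩ := zplus_spec hb hc h1b hab
  refine main_aux ha hb hc h1b hp hcz heq τ hτ z hinit hnz (fun n hn => ?_)
  have := hrec (n - τ)
  rwa [Nat.sub_add_cancel hn] at this
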